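/- Typable terms are good, have good types and good environments, and have the same degree as their types: for i ∈ {1,2}, if M : ⟨Γ ⊢ᵢ U⟩ is derivable, then M ∈ 𝕄, Γ is good, U is good, and d(M) = d(U). -/

import Mathlib

/-! Common development: the indexed λI-calculus (the λI^ℕ-calculus), types with
expansion variables, the realisability semantics, and the typing systems ⊢1 and ⊢2. -/

/-- The set of variables 𝓥, split as the disjoint union of two denumerably
infinite sets 𝓥₁ (`Sum.inl`) and 𝓥₂ (`Sum.inr`). -/
abbrev Vr : Type := ℕ ⊕ ℕ

/-- Raw terms of the λI^ℕ-calculus: every variable occurrence carries a degree. -/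
inductive Trm : Type
  | var : Vr → ℕ → Trm
  | app : Trm → Trm → Trm
  | lam : Vr → ℕ → Trm → Trm
  deriving DecidableEq

namespace Trm

/-- Free indexed variables `FV M`. -/
def FV : Trm → Set (Vr × ℕ)
  | var x n => {(x, n)}
  | app M N => FV M ∪ FV N
  | lam x n M => FV M \ {(x, n)}

/-- Names that are λ-bound somewhere in the term. -/
def BV : Trm → Set Vr
  | var _ _ => ∅
  | app M N => BV M ∪ BV N
  | lam x _ M => insert x (BV M)

/-- Degree `d(M)` of a term. -/
def deg : Trm → ℕ
  | var _ n => n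
  | app M N => min (deg M) (deg N)
  | lam _ _ M => deg M

/-- Joinability `M ◇ N`: any variable free in both occurs with the same degree. -/
def Joinable (M N : Trm) : Prop :=
  ∀ x m n, (x, m) ∈ FV M → (x, n) ∈ FV N → m = n

/-- Membership in the set 𝓜 of terms (λI-condition and joinability at applications). -/
inductive InM : Trm → Prop
  | var (x : Vr) (n : ℕ) : InM (Trm.var x n)
  | app {M N : Trm} : InM M → InM N → Joinable M N → InM (Trm.app M N)
  | lam {M : Trm} {x : Vr} {n : ℕ} : InM M → (x, n) ∈ FV M → InM (Trm.lam x n M)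

/-- The good terms 𝕄: the degree of a function is never larger than that of
its argument. -/
inductive Good : Trm → Prop
  | var (x : Vr) (n : ℕ) : Good (Trm.var x n)
  | app {M N : Trm} : Good M → Good N → Joinable M N → deg M ≤ deg N →
      Good (Trm.app M N)
  | lam {M : Trm} {x : Vr} {n : ℕ} : Good M → (x, n) ∈ FV M → Good (Trm.lam x n M)

/-- Substitution of `N` for `x^n` (capture is excluded by side conditions on its
uses, following the Barendregt convention). -/
def subst (x : Vr) (n : ℕ) (N : Trm) : Trm → Trm
  | var y m => if y = x ∧ m = n then N else var y m
  | app P Q => app (subst x n N P) (subst x n N Q)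
  | lam y m P => if y = x ∧ m = n then lam y m P else lam y m (subst x n N P)

/-- `M⁺`: raise every degree index by one. -/
def lift : Trm → Trm
  | var x n => var x (n + 1)
  | app M N => app (lift M) (lift N)
  | lam x n M => lam x (n + 1) (lift M)

/-- One-step β-reduction `▷β`: the least compatible relation closed under the
rule `(λx^n.M)N ▷β M[x^n := N]` when `d(N) = n` (the λI-condition `x^n ∈ FV M`
and the absence of capture come from working with terms of 𝓜 modulo α under
the Barendregt convention). -/
inductive Beta : Trm → Trm → Prop
  | redex {x : Vr} {n : ℕ} {M N : Trm} :
      (x, n) ∈ FV M → deg N = n →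
      (∀ y m, (y, m) ∈ FV N → y ∉ BV M) →
      Beta (Trm.app (Trm.lam x n M) N) (subst x n N M)
  | lam {M N : Trm} {x : Vr} {n : ℕ} :
      Beta M N → (x, n) ∈ FV M → (x, n) ∈ FV N →
      Beta (Trm.lam x n M) (Trm.lam x n N)
  | appL {M N P : Trm} :
      Beta M N → Joinable M P → Joinable N P →
      Beta (Trm.app M P) (Trm.app N P)
  | appR {M N P : Trm} :
      Beta M N → Joinable P M → Joinable P N →
      Beta (Trm.app P M) (Trm.app P N)

/-- `▷β*`: the reflexive transitive closure of `▷β`. -/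
def Betas : Trm → Trm → Prop := Relation.ReflTransGen Beta

end Trm

/-- `𝕄ⁿ`: the good terms of degree `n`. -/
def Mdeg (n : ℕ) : Set Trm := {M | Trm.Good M ∧ Trm.deg M = n}

/-- A set of terms is saturated iff it is closed under β-expansion. -/
def Saturated (X : Set Trm) : Prop := ∀ M N, Trm.Betas M N → N ∈ X → M ∈ X

/-- `X ⤳ Y`. -/
def ArrSet (X Y : Set Trm) : Set Trm :=
  {M | ∀ N ∈ X, Trm.Joinable M N → Trm.app M N ∈ Y}

/-- `𝓝ₓⁿ = {x^n N₁ … N_k ∈ 𝕄 ∣ k ≥ 0}` for `x ∈ 𝓥₁`. -/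
def NSet (x n : ℕ) : Set Trm :=
  {M | Trm.Good M ∧ ∃ l : List Trm, M = l.foldl Trm.app (Trm.var (Sum.inl x) n)}

/-- Types over the denumerable set ℕ of atomic types and a set `E` of expansion
variables. -/
inductive Ty (E : Type) : Type
  | atom : ℕ → Ty E
  | arr : Ty E → Ty E → Ty E
  | inter : Ty E → Ty E → Ty E
  | exp : E → Ty E → Ty E

namespace Ty

variable {E : Type}

/-- Degree `d(U)` of a type. -/
def deg : Ty E → ℕ
  | atom _ => 0
  | arr U T => min (deg U) (deg T)
  | inter U V => min (deg U) (deg V)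
  | exp _ U => deg U + 1

/-- Good types. -/
inductive GoodTy : Ty E → Prop
  | atom (a : ℕ) : GoodTy (Ty.atom a)
  | exp {U : Ty E} (e : E) : GoodTy U → GoodTy (Ty.exp e U)
  | arr {U T : Ty E} : GoodTy U → GoodTy T → deg T ≤ deg U → GoodTy (Ty.arr U T)
  | inter {U V : Ty E} : GoodTy U → GoodTy V → deg U = deg V → GoodTy (Ty.inter U V)

mutual
  /-- The restricted types 𝕋 (no arrow on the left of ⊓ or of an expansion). -/
  inductive IsT : Ty E → Prop
    | atom (a : ℕ) : IsT (Ty.atom a)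
    | arr {U T : Ty E} : IsU U → IsT T → IsT (Ty.arr U T)
  /-- The restricted types 𝕌. -/
  inductive IsU : Ty E → Prop
    | ofT {T : Ty E} : IsT T → IsU T
    | inter {U V : Ty E} : IsU U → IsU V → IsU (Ty.inter U V)
    | exp {U : Ty E} (e : E) : IsU U → IsU (Ty.exp e U)
end

/-- Equality of types induced by the quotient (⊓ commutative, associative,
idempotent, and `e(U₁ ⊓ U₂) = eU₁ ⊓ eU₂`), as a congruence. -/
inductive TEq : Ty E → Ty E → Prop
  | refl (U : Ty E) : TEq U U
  | symm {U V : Ty E} : TEq U V → TEq V U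
  | trans {U V W : Ty E} : TEq U V → TEq V W → TEq U W
  | comm (U V : Ty E) : TEq (Ty.inter U V) (Ty.inter V U)
  | assoc (U V W : Ty E) : TEq (Ty.inter (Ty.inter U V) W) (Ty.inter U (Ty.inter V W))
  | idem (U : Ty E) : TEq (Ty.inter U U) U
  | dist (e : E) (U V : Ty E) :
      TEq (Ty.exp e (Ty.inter U V)) (Ty.inter (Ty.exp e U) (Ty.exp e V))
  | arrCongr {U U' T T' : Ty E} : TEq U U' → TEq T T' → TEq (Ty.arr U T) (Ty.arr U' T')
  | interCongr {U U' V V' : Ty E} : TEq U U' → TEq V V' →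
      TEq (Ty.inter U V) (Ty.inter U' V')
  | expCongr (e : E) {U U' : Ty E} : TEq U U' → TEq (Ty.exp e U) (Ty.exp e U')

/-- The degree-decreasing operation `U⁻` (meaningful when `d(U) > 0`). -/
def tmin : Ty E → Ty E
  | exp _ U => U
  | inter U V => inter (tmin U) (tmin V)
  | atom a => atom a
  | arr U T => arr U T

/-- The subtyping relation ⊑ on 𝕌.  It contains the quotient equality `TEq`,
which makes it reflexive on equivalence classes of types. -/
inductive TSub : Ty E → Ty E → Prop
  | ofEq {U V : Ty E} : TEq U V → TSub U V
  | trans {U V W : Ty E} : TSub U V → TSub V W → TSub U W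
  | interElim {U₁ U₂ : Ty E} : GoodTy U₂ → deg U₁ = deg U₂ →
      TSub (Ty.inter U₁ U₂) U₁
  | interCongr {U₁ U₂ V₁ V₂ : Ty E} : TSub U₁ V₁ → TSub U₂ V₂ →
      TSub (Ty.inter U₁ U₂) (Ty.inter V₁ V₂)
  | arr {U₁ U₂ T₁ T₂ : Ty E} : TSub U₂ U₁ → TSub T₁ T₂ →
      TSub (Ty.arr U₁ T₁) (Ty.arr U₂ T₂)
  | expCongr (e : E) {U V : Ty E} : TSub U V → TSub (Ty.exp e U) (Ty.exp e V)

end Ty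

/-- Type environments: finite maps from indexed variables to types. -/
abbrev Env (E : Type) : Type := Vr × ℕ → Option (Ty E)

namespace Env

variable {E : Type}

/-- The empty environment `()`. -/
def empty : Env E := fun _ => none

def dom (Γ : Env E) : Set (Vr × ℕ) := {p | Γ p ≠ none}

/-- The singleton environment `(x^n : U)`. -/
def single (p : Vr × ℕ) (U : Ty E) : Env E := fun q => if q = p then some U else none

/-- The extension `Γ, (x^n : U)`. -/
def update (Γ : Env E) (p : Vr × ℕ) (U : Ty E) : Env E :=
  fun q => if q = p then some U else Γ q

/-- Joinability `Γ₁ ◇ Γ₂` of environments. -/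
def Joinable (Γ₁ Γ₂ : Env E) : Prop :=
  ∀ x m n, (x, m) ∈ dom Γ₁ → (x, n) ∈ dom Γ₂ → m = n

/-- `Γ₁ ⊓ Γ₂`. -/
def inter (Γ₁ Γ₂ : Env E) : Env E := fun p =>
  match Γ₁ p, Γ₂ p with
  | some U, some V => some (Ty.inter U V)
  | some U, none => some U
  | none, o => o

/-- `eΓ`: apply `e` to every type of `Γ` and raise every variable index by one. -/
def eexp (e : E) (Γ : Env E) : Env E := fun p =>
  match p with
  | (_, 0) => none
  | (x, n + 1) => (Γ (x, n)).map (Ty.exp e)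

/-- A good environment. -/
def Good (Γ : Env E) : Prop := ∀ p U, Γ p = some U → Ty.GoodTy U

/-- Environments equal up to the quotient equality on types. -/
def EqT (Γ Γ' : Env E) : Prop :=
  (∀ p, Γ p = none ↔ Γ' p = none) ∧
  ∀ p U U', Γ p = some U → Γ' p = some U' → Ty.TEq U U'

/-- Pointwise subtyping of environments (with the same domain). -/
def LE (Γ Γ' : Env E) : Prop :=
  (∀ p, Γ p = none ↔ Γ' p = none) ∧
  ∀ p U U', Γ p = some U → Γ' p = some U' → Ty.TSub U U'

end Env

/-- The typing system ⊢1 (types range over the full set 𝓣). -/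
inductive Der1 {E : Type} : Trm → Env E → Ty E → Prop
  | ax (x : Vr) (n : ℕ) {T : Ty E} : Ty.GoodTy T → Ty.deg T = n →
      Der1 (Trm.var x n) (Env.single (x, n) T) T
  | arrI {Γ : Env E} {x : Vr} {n : ℕ} {M : Trm} {U T : Ty E} :
      Γ (x, n) = none → Der1 M (Env.update Γ (x, n) U) T →
      Der1 (Trm.lam x n M) Γ (Ty.arr U T)
  | arrE {Γ₁ Γ₂ : Env E} {M₁ M₂ : Trm} {U T : Ty E} :
      Der1 M₁ Γ₁ (Ty.arr U T) → Der1 M₂ Γ₂ U → Env.Joinable Γ₁ Γ₂ →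
      Der1 (Trm.app M₁ M₂) (Env.inter Γ₁ Γ₂) T
  | inter {Γ₁ Γ₂ : Env E} {M : Trm} {U₁ U₂ : Ty E} :
      Der1 M Γ₁ U₁ → Der1 M Γ₂ U₂ →
      Der1 M (Env.inter Γ₁ Γ₂) (Ty.inter U₁ U₂)
  | exp (e : E) {Γ : Env E} {M : Trm} {U : Ty E} :
      Der1 M Γ U → Der1 (Trm.lift M) (Env.eexp e Γ) (Ty.exp e U)
  | eq {Γ Γ' : Env E} {M : Trm} {U U' : Ty E} :
      Der1 M Γ U → Env.EqT Γ Γ' → Ty.TEq U U' → Der1 M Γ' U'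

/-- The typing system ⊢2 (types range over 𝕌, with `T` ranging over 𝕋),
with the subsumption rule for ⊑. -/
inductive Der2 {E : Type} : Trm → Env E → Ty E → Prop
  | ax (x : Vr) {T : Ty E} : Ty.IsT T → Ty.GoodTy T →
      Der2 (Trm.var x 0) (Env.single (x, 0) T) T
  | arrI {Γ : Env E} {x : Vr} {n : ℕ} {M : Trm} {U T : Ty E} :
      Ty.IsU U → Ty.IsT T →
      Γ (x, n) = none → Der2 M (Env.update Γ (x, n) U) T →
      Der2 (Trm.lam x n M) Γ (Ty.arr U T)
  | arrE {Γ₁ Γ₂ : Env E} {M₁ M₂ : Trm} {U T : Ty E} :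
      Ty.IsU U → Ty.IsT T →
      Der2 M₁ Γ₁ (Ty.arr U T) → Der2 M₂ Γ₂ U → Env.Joinable Γ₁ Γ₂ →
      Der2 (Trm.app M₁ M₂) (Env.inter Γ₁ Γ₂) T
  | inter {Γ₁ Γ₂ : Env E} {M : Trm} {U₁ U₂ : Ty E} :
      Der2 M Γ₁ U₁ → Der2 M Γ₂ U₂ →
      Der2 M (Env.inter Γ₁ Γ₂) (Ty.inter U₁ U₂)
  | exp (e : E) {Γ : Env E} {M : Trm} {U : Ty E} :
      Der2 M Γ U → Der2 (Trm.lift M) (Env.eexp e Γ) (Ty.exp e U)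
  | sub {Γ Γ' : Env E} {M : Trm} {U U' : Ty E} :
      Der2 M Γ U → Ty.TSub U U' → Env.LE Γ' Γ → Der2 M Γ' U'

/-- An interpretation `𝓘 : 𝓐 → 𝓟(𝓜⁰)`: each `𝓘(a)` is saturated and
`𝓝ₓ⁰ ⊆ 𝓘(a) ⊆ 𝕄⁰` for every `x ∈ 𝓥₁`. -/
def IsInterp (I : ℕ → Set Trm) : Prop :=
  ∀ a : ℕ, Saturated (I a) ∧ (∀ x : ℕ, NSet x 0 ⊆ I a) ∧ I a ⊆ Mdeg 0

/-- The extension of an interpretation to all types: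
`𝓘(eU) = 𝓘(U)⁺`, `𝓘(U ⊓ V) = 𝓘(U) ∩ 𝓘(V)`, `𝓘(U → T) = 𝓘(U) ⤳ 𝓘(T)`. -/
def IntExt {E : Type} (I : ℕ → Set Trm) : Ty E → Set Trm
  | Ty.atom a => I a
  | Ty.arr U T => ArrSet (IntExt I U) (IntExt I T)
  | Ty.inter U V => IntExt I U ∩ IntExt I V
  | Ty.exp _ U => Trm.lift '' IntExt I U

/-- The meaning `[U]` of a type: the closed terms belonging to `𝓘(U)` for
every interpretation `𝓘`. -/
def Mean {E : Type} (U : Ty E) : Set Trm :=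
  {M | Trm.InM M ∧ Trm.FV M = ∅ ∧ ∀ I : ℕ → Set Trm, IsInterp I → M ∈ IntExt I U}

/-- Simultaneous substitution along a finite assignment `σ`. -/
def msubst (σ : Vr × ℕ → Option Trm) : Trm → Trm
  | Trm.var x n => (σ (x, n)).getD (Trm.var x n)
  | Trm.app M N => Trm.app (msubst σ M) (msubst σ N)
  | Trm.lam x n M => Trm.lam x n (msubst (fun p => if p = (x, n) then none else σ p) M)

/-- The simultaneous substitution `M[(xⱼ^{nⱼ} := Nⱼ)ⱼ]` is defined: the set
`{M} ∪ {Nⱼ ∣ j}` is pairwise joinable and (Barendregt convention) no capture occurs. -/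
def SubstDefined (σ : Vr × ℕ → Option Trm) (M : Trm) : Prop :=
  (∀ p N, σ p = some N → Trm.Joinable M N) ∧
  (∀ p q N N', σ p = some N → σ q = some N' → Trm.Joinable N N') ∧
  (∀ p N y m, σ p = some N → (y, m) ∈ Trm.FV N → y ∉ Trm.BV M)

namespace Trm

theorem deg_le_of_mem_FV {M : Trm} {x : Vr} {n : ℕ} (h : (x, n) ∈ FV M) : deg M ≤ n := by
  induction M with
  | var y m => simp_all [FV, deg]
  | app M N ihM ihN =>
    rcases h with h | h
    · exact (min_le_left _ _).trans (ihM h)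
    · exact (min_le_right _ _).trans (ihN h)
  | lam y m M ih => exact ih h.1

theorem deg_lift (M : Trm) : deg (lift M) = deg M + 1 := by
  induction M with
  | var x n => rfl
  | app M N ihM ihN => simp only [lift, deg, ihM, ihN]; omega
  | lam x n M ih => exact ih

theorem mem_FV_lift_succ {M : Trm} {x : Vr} {n : ℕ} :
    (x, n + 1) ∈ FV (lift M) ↔ (x, n) ∈ FV M := by
  induction M with
  | var y m => simp [lift, FV]
  | app M N ihM ihN => simp [lift, FV, ihM, ihN]
  | lam y m M ih => simp [lift, FV, ih]

theorem not_mem_FV_lift_zero {M : Trm} {x : Vr} : (x, 0) ∉ FV (lift M) := by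
  induction M with
  | var y m => simp [lift, FV]
  | app M N ihM ihN => simp [lift, FV, ihM, ihN]
  | lam y m M ih => simp [lift, FV, ih]

theorem Joinable.lift {M N : Trm} (h : Joinable M N) : Joinable (lift M) (lift N) := by
  rintro x (_ | m) (_ | n) hm hn
  · rfl
  · exact absurd hm not_mem_FV_lift_zero
  · exact absurd hn not_mem_FV_lift_zero
  · rw [h x m n (mem_FV_lift_succ.1 hm) (mem_FV_lift_succ.1 hn)]

theorem Good.lift {M : Trm} (h : Good M) : Good (lift M) := by
  induction h with
  | var x n => exact .var x (n + 1)
  | app _ _ hJ hd ihM ihN =>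
    exact .app ihM ihN hJ.lift (by simpa only [deg_lift, add_le_add_iff_right] using hd)
  | lam _ hx ih => exact .lam ih (mem_FV_lift_succ.2 hx)

end Trm

namespace Ty

variable {E : Type}

theorem goodTy_exp_iff {e : E} {U : Ty E} : GoodTy (exp e U) ↔ GoodTy U :=
  ⟨fun h => by cases h; assumption, .exp e⟩

theorem goodTy_arr_iff {U T : Ty E} :
    GoodTy (arr U T) ↔ GoodTy U ∧ GoodTy T ∧ deg T ≤ deg U :=
  ⟨fun h => by cases h; exact ⟨‹_›, ‹_›, ‹_›⟩, fun h => .arr h.1 h.2.1 h.2.2⟩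

theorem goodTy_inter_iff {U V : Ty E} :
    GoodTy (inter U V) ↔ GoodTy U ∧ GoodTy V ∧ deg U = deg V :=
  ⟨fun h => by cases h; exact ⟨‹_›, ‹_›, ‹_›⟩, fun h => .inter h.1 h.2.1 h.2.2⟩

theorem TEq.deg_eq_and_goodTy_iff {U V : Ty E} (h : TEq U V) :
    deg U = deg V ∧ (GoodTy U ↔ GoodTy V) := by
  induction h with
  | refl U => exact ⟨rfl, Iff.rfl⟩
  | symm _ ih => exact ⟨ih.1.symm, ih.2.symm⟩
  | trans _ _ ih₁ ih₂ => exact ⟨ih₁.1.trans ih₂.1, ih₁.2.trans ih₂.2⟩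
  | comm | assoc | idem | dist | arrCongr | interCongr | expCongr =>
    simp only [deg, goodTy_inter_iff, goodTy_exp_iff, goodTy_arr_iff]
    grind

theorem TSub.deg_eq_and_goodTy_iff {U V : Ty E} (h : TSub U V) :
    deg U = deg V ∧ (GoodTy U ↔ GoodTy V) := by
  induction h with
  | ofEq h => exact h.deg_eq_and_goodTy_iff
  | trans _ _ ih₁ ih₂ => exact ⟨ih₁.1.trans ih₂.1, ih₁.2.trans ih₂.2⟩
  | interElim | interCongr | arr | expCongr =>
    simp only [deg, goodTy_inter_iff, goodTy_exp_iff, goodTy_arr_iff]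
    grind

end Ty

/-- The invariant of typing derivations: besides the goodness and degree properties, the
environment declares exactly the free variables, each with a type of the degree of its index. -/
structure GoodTyping {E : Type} (M : Trm) (Γ : Env E) (U : Ty E) : Prop where
  good : Trm.Good M
  env : ∀ p V, Γ p = some V → Ty.GoodTy V ∧ Ty.deg V = p.2
  ty : Ty.GoodTy U
  deg_eq : Trm.deg M = Ty.deg U
  mem_FV_iff : ∀ p, p ∈ Trm.FV M ↔ Γ p ≠ none

namespace GoodTyping

variable {E : Type} {M M₁ M₂ : Trm} {Γ Γ' Γ₁ Γ₂ : Env E} {U U' U₁ U₂ T : Ty E}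

theorem var (x : Vr) {n : ℕ} (hT : Ty.GoodTy T) (hd : Ty.deg T = n) :
    GoodTyping (Trm.var x n) (Env.single (x, n) T) T where
  good := .var x n
  env p V h := by
    unfold Env.single at h
    split at h <;> simp_all
  ty := hT
  deg_eq := hd.symm
  mem_FV_iff p := by simp [Trm.FV, Env.single]

theorem lam {x : Vr} {n : ℕ} (hx : Γ (x, n) = none)
    (h : GoodTyping M (Env.update Γ (x, n) U) T) : GoodTyping (Trm.lam x n M) Γ (Ty.arr U T) := by
  obtain ⟨hU, hdU⟩ := h.env (x, n) U (by simp [Env.update])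
  have hmem : (x, n) ∈ Trm.FV M := (h.mem_FV_iff _).2 (by simp [Env.update])
  have hle : Ty.deg T ≤ Ty.deg U := by
    rw [hdU, ← h.deg_eq]
    exact Trm.deg_le_of_mem_FV hmem
  refine ⟨.lam h.good hmem, fun p V hp => h.env p V ?_, .arr hU h.ty hle, ?_, fun p => ?_⟩
  · have : p ≠ (x, n) := by
      rintro rfl
      simp [hx] at hp
    simpa [Env.update, this] using hp
  · simpa [Trm.deg, Ty.deg, hle] using h.deg_eq
  · have := h.mem_FV_iff p
    by_cases hp : p = (x, n)
    · simp [Trm.FV, hp, hx]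
    · simpa [Trm.FV, Env.update, hp] using this

theorem env_inter (h₁ : ∀ p V, Γ₁ p = some V → Ty.GoodTy V ∧ Ty.deg V = p.2)
    (h₂ : ∀ p V, Γ₂ p = some V → Ty.GoodTy V ∧ Ty.deg V = p.2) (p : Vr × ℕ) (V : Ty E)
    (h : Env.inter Γ₁ Γ₂ p = some V) : Ty.GoodTy V ∧ Ty.deg V = p.2 := by
  have h₁ := h₁ p
  have h₂ := h₂ p
  unfold Env.inter at h
  split at h
  · next U₁ U₂ e₁ e₂ =>
    obtain ⟨g₁, d₁⟩ := h₁ _ e₁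
    obtain ⟨g₂, d₂⟩ := h₂ _ e₂
    cases h
    exact ⟨.inter g₁ g₂ (d₁.trans d₂.symm), by simp [Ty.deg, d₁, d₂]⟩
  · next e₁ _ => exact h₁ _ (e₁.trans h)
  · exact h₂ _ h

theorem inter_ne_none_iff (p : Vr × ℕ) :
    Env.inter Γ₁ Γ₂ p ≠ none ↔ Γ₁ p ≠ none ∨ Γ₂ p ≠ none := by
  unfold Env.inter
  split <;> simp_all

theorem app (h₁ : GoodTyping M₁ Γ₁ (Ty.arr U T)) (h₂ : GoodTyping M₂ Γ₂ U)
    (hJ : Env.Joinable Γ₁ Γ₂) : GoodTyping (Trm.app M₁ M₂) (Env.inter Γ₁ Γ₂) T := by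
  obtain ⟨-, hT, hle⟩ := Ty.goodTy_arr_iff.1 h₁.ty
  have hd₁ : Trm.deg M₁ = Ty.deg T := by simpa [Ty.deg, hle] using h₁.deg_eq
  have hle' : Trm.deg M₁ ≤ Trm.deg M₂ := by rwa [hd₁, h₂.deg_eq]
  refine ⟨.app h₁.good h₂.good (fun x m n hm hn => hJ x m n ((h₁.mem_FV_iff _).1 hm)
    ((h₂.mem_FV_iff _).1 hn)) hle', env_inter h₁.env h₂.env, hT, ?_, fun p => ?_⟩
  · simpa [Trm.deg, hle'] using hd₁
  · rw [inter_ne_none_iff, ← h₁.mem_FV_iff, ← h₂.mem_FV_iff]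
    rfl

theorem inter (h₁ : GoodTyping M Γ₁ U₁) (h₂ : GoodTyping M Γ₂ U₂) :
    GoodTyping M (Env.inter Γ₁ Γ₂) (Ty.inter U₁ U₂) where
  good := h₁.good
  env := env_inter h₁.env h₂.env
  ty := .inter h₁.ty h₂.ty (h₁.deg_eq.symm.trans h₂.deg_eq)
  deg_eq := by simp [Ty.deg, ← h₁.deg_eq, ← h₂.deg_eq]
  mem_FV_iff p := by rw [inter_ne_none_iff, ← h₁.mem_FV_iff, ← h₂.mem_FV_iff, or_self]

theorem exp (e : E) (h : GoodTyping M Γ U) :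
    GoodTyping (Trm.lift M) (Env.eexp e Γ) (Ty.exp e U) where
  good := h.good.lift
  env := by
    rintro ⟨x, _ | n⟩ V hV
    · simp [Env.eexp] at hV
    · obtain ⟨W, hW, rfl⟩ := Option.map_eq_some_iff.1 hV
      obtain ⟨hg, hd⟩ := h.env _ _ hW
      exact ⟨.exp e hg, congrArg (· + 1) hd⟩
  ty := .exp e h.ty
  deg_eq := by rw [Trm.deg_lift, h.deg_eq, Ty.deg]
  mem_FV_iff := by
    rintro ⟨x, _ | n⟩
    · simp [Env.eexp, Trm.not_mem_FV_lift_zero]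
    · simp [Env.eexp, Trm.mem_FV_lift_succ, h.mem_FV_iff]

theorem congr (h : GoodTyping M Γ U) (hdom : ∀ p, Γ p = none ↔ Γ' p = none)
    (hΓ : ∀ p V V', Γ p = some V → Γ' p = some V' →
      Ty.deg V = Ty.deg V' ∧ (Ty.GoodTy V ↔ Ty.GoodTy V'))
    (hU : Ty.deg U = Ty.deg U' ∧ (Ty.GoodTy U ↔ Ty.GoodTy U')) : GoodTyping M Γ' U' where
  good := h.good
  env p V' hV' := by
    have hne : Γ p ≠ none := fun h0 => by simp [(hdom p).1 h0] at hV'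
    obtain ⟨V, hV⟩ := Option.ne_none_iff_exists'.1 hne
    obtain ⟨hd, hg⟩ := hΓ p V V' hV hV'
    obtain ⟨g, d⟩ := h.env p V hV
    exact ⟨hg.1 g, hd.symm.trans d⟩
  ty := hU.2.1 h.ty
  deg_eq := h.deg_eq.trans hU.1
  mem_FV_iff p := (h.mem_FV_iff p).trans (hdom p).not

end GoodTyping

theorem Der1.goodTyping {E : Type} {M : Trm} {Γ : Env E} {U : Ty E} (h : Der1 M Γ U) :
    GoodTyping M Γ U := by
  induction h with
  | ax x n hT hd => exact .var x hT hd
  | arrI hx _ ih => exact ih.lam hx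
  | arrE _ _ hJ ih₁ ih₂ => exact ih₁.app ih₂ hJ
  | inter _ _ ih₁ ih₂ => exact ih₁.inter ih₂
  | exp e _ ih => exact ih.exp e
  | eq _ hΓ hU ih =>
    exact ih.congr hΓ.1 (fun p V V' hV hV' => (hΓ.2 p V V' hV hV').deg_eq_and_goodTy_iff)
      hU.deg_eq_and_goodTy_iff

theorem Ty.IsT.deg_eq_zero {E : Type} {T : Ty E} (h : IsT T) : deg T = 0 := by
  induction T with
  | atom a => rfl
  | arr U T _ ih =>
    cases h with
    | arr _ hT => simp [deg, ih hT]
  | inter U V => cases h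
  | exp e U => cases h

theorem Der2.goodTyping {E : Type} {M : Trm} {Γ : Env E} {U : Ty E} (h : Der2 M Γ U) :
    GoodTyping M Γ U := by
  induction h with
  | ax x hT hg => exact .var x hg hT.deg_eq_zero
  | arrI _ _ hx _ ih => exact ih.lam hx
  | arrE _ _ _ _ hJ ih₁ ih₂ => exact ih₁.app ih₂ hJ
  | inter _ _ ih₁ ih₂ => exact ih₁.inter ih₂
  | exp e _ ih => exact ih.exp e
  | sub _ hU hΓ ih =>
    refine ih.congr (fun p => (hΓ.1 p).symm) (fun p V V' hV hV' => ?_) hU.deg_eq_and_goodTy_iff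
    obtain ⟨hd, hg⟩ := (hΓ.2 p V' V hV' hV).deg_eq_and_goodTy_iff
    exact ⟨hd.symm, hg.symm⟩

theorem GoodTyping.env_good {E : Type} {M : Trm} {Γ : Env E} {U : Ty E}
    (h : GoodTyping M Γ U) : Env.Good Γ :=
  fun p V hV => (h.env p V hV).1

/-- for `i ∈ {1,2}`, if `M : ⟨Γ ⊢ᵢ U⟩` is derivable, then
`M ∈ 𝕄`, `Γ` is good, `U` is good, and `d(M) = d(U)`. -/
theorem typable_terms_good {E : Type} :
    (∀ (M : Trm) (Γ : Env E) (U : Ty E), Der1 M Γ U →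
      Trm.Good M ∧ Env.Good Γ ∧ Ty.GoodTy U ∧ Trm.deg M = Ty.deg U) ∧
    (∀ (M : Trm) (Γ : Env E) (U : Ty E), Der2 M Γ U →
      Trm.Good M ∧ Env.Good Γ ∧ Ty.GoodTy U ∧ Trm.deg M = Ty.deg U) := by
  refine ⟨fun M Γ U h => ?_, fun M Γ U h => ?_⟩
  · exact ⟨h.goodTyping.good, h.goodTyping.env_good, h.goodTyping.ty, h.goodTyping.deg_eq⟩
  · exact ⟨h.goodTyping.good, h.goodTyping.env_good, h.goodTyping.ty, h.goodTyping.deg_eq⟩
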